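/- For every m ≥ 1 and every basepoint p₀ ∈ U_m, the fundamental group π₁(U_m, p₀) is isomorphic to the braid group Br_m. -/

import Mathlib

open Polynomial

noncomputable section

/-- Defining relations of the Artin braid group on `m` strands: the generators are
indexed by `Fin (m - 1)`, with index `i` corresponding to `σ_{i+1}`; the relations are
`σ_i σ_j = σ_j σ_i` for `|i - j| ≥ 2` and `σ_i σ_{i+1} σ_i = σ_{i+1} σ_i σ_{i+1}`. -/
def braidRels (m : ℕ) : Set (FreeGroup (Fin (m - 1))) :=
  { r | (∃ i j : Fin (m - 1), (i : ℕ) + 2 ≤ (j : ℕ) ∧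
          r = .of i * .of j * (.of i)⁻¹ * (.of j)⁻¹) ∨
        (∃ i j : Fin (m - 1), (j : ℕ) = (i : ℕ) + 1 ∧
          r = .of i * .of j * .of i * (.of j * .of i * .of j)⁻¹) }

/-- The Artin braid group on `m` strands. -/
def BraidGroup (m : ℕ) : Type := PresentedGroup (braidRels m)

instance (m : ℕ) : Group (BraidGroup m) :=
  inferInstanceAs (Group (PresentedGroup (braidRels m)))

/-- The Artin generator `σ_i` of the braid group on `m` strands, for `1 ≤ i ≤ m - 1`
(junk value `1` for invalid indices). -/
def σg (m : ℕ) (i : ℕ) : BraidGroup m :=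
  if h : 0 < i ∧ i < m then PresentedGroup.of ⟨i - 1, by omega⟩ else 1

/-- The band generator `σ_{i,j} = (σ_{j-1} σ_{j-2} ⋯ σ_{i+1}) σ_i (σ_{j-1} σ_{j-2} ⋯ σ_{i+1})⁻¹`
of the braid group on `m` strands; in particular `σ_{i,i+1} = σ_i`. -/
def band (m i j : ℕ) : BraidGroup m :=
  (((List.range' (i + 1) (j - i - 1)).reverse.map (σg m)).prod) * σg m i *
    (((List.range' (i + 1) (j - i - 1)).reverse.map (σg m)).prod)⁻¹

/-- The monic polynomial `X^m + a_{m-1} X^{m-1} + ⋯ + a_1 X + a_0` associated to the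
coefficient vector `a ∈ ℂ^m`. -/
def polyOf (m : ℕ) (a : Fin m → ℂ) : ℂ[X] :=
  X ^ m + ∑ i : Fin m, C (a i) * X ^ (i : ℕ)

/-- The space `U_m` of monic univariate complex polynomials of degree `m` with simple
roots only, topologized as the subspace of coefficient vectors in `ℂ^m` whose
associated monic polynomial is squarefree. -/
def UPoly (m : ℕ) : Type := { a : Fin m → ℂ // Squarefree (polyOf m a) }

instance (m : ℕ) : TopologicalSpace (UPoly m) :=
  instTopologicalSpaceSubtype

section Subdivision

open Topology unitInterval

variable {X : Type*} [TopologicalSpace X]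

/-- A property of homotopy classes of paths that is stable under concatenation and holds for paths
contained in a member of an open cover holds for all homotopy classes of paths. -/
theorem Path.Homotopic.Quotient.induction_of_open_cover {ι : Type*} {V : ι → Set X}
    (hV : ∀ i, IsOpen (V i)) (hcov : ∀ x, ∃ i, x ∈ V i)
    {motive : ∀ {x y : X}, Path.Homotopic.Quotient x y → Prop}
    (small : ∀ i {x y : X} (γ : Path x y), (∀ t, γ t ∈ V i) →
      motive (Path.Homotopic.Quotient.mk γ))
    (trans : ∀ {x y z : X} (p : Path.Homotopic.Quotient x y) (q : Path.Homotopic.Quotient y z),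
      motive p → motive q → motive (p.trans q))
    {x y : X} (p : Path.Homotopic.Quotient x y) : motive p := by
  induction p using Path.Homotopic.Quotient.ind with | mk γ => ?_
  obtain ⟨t, ht0, hmono, ⟨n, hn⟩, hsub⟩ := exists_monotone_Icc_subset_open_cover_unitInterval
    (c := fun i => γ ⁻¹' V i) (fun i => (hV i).preimage γ.continuous) (fun s _ => by
      obtain ⟨i, hi⟩ := hcov (γ s)
      exact Set.mem_iUnion.2 ⟨i, hi⟩)
  have step : ∀ k, motive (Path.Homotopic.Quotient.mk (γ.subpath (t k) (t (k + 1)))) := by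
    intro k
    obtain ⟨i, hi⟩ := hsub k
    refine small i _ fun s => ?_
    have : γ.subpath (t k) (t (k + 1)) s ∈ Set.range (γ.subpath (t k) (t (k + 1))) := ⟨s, rfl⟩
    rw [Path.range_subpath_of_le _ _ _ (hmono k.le_succ)] at this
    obtain ⟨r, hr, hrs⟩ := this
    exact hrs ▸ hi hr
  have all : ∀ k, motive (Path.Homotopic.Quotient.mk (γ.subpath (t 0) (t (k + 1)))) := by
    intro k
    induction k with
    | zero => exact step 0
    | succ k ih =>
      have := trans _ _ ih (step (k + 1))
      rw [← Path.Homotopic.Quotient.mk_trans] at this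
      rwa [Path.Homotopic.Quotient.eq.2 ⟨Path.Homotopy.subpathTransSubpath γ _ _ _⟩] at this
  have h1 := all n
  rw [ht0, hn (n + 1) n.le_succ, Path.subpath_zero_one] at h1
  have key : ∀ {a b : X} (ha : a = x) (hb : b = y),
      motive (Path.Homotopic.Quotient.mk (γ.cast ha hb)) →
      motive (Path.Homotopic.Quotient.mk γ) := by
    rintro a b rfl rfl h
    exact h
  exact key _ _ h1

end Subdivision

section Monodromy

open Topology unitInterval

variable {X ι G : Type*} [TopologicalSpace X] [Group G] [TopologicalSpace G] [DiscreteTopology G]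
  {V : ι → Set X} {h : ι → X → G}

/-- The fibre bundle with discrete fibre `G` whose transition functions are the locally constant
functions `(h j)⁻¹ * h i`. -/
def jumpBundleCore (hV : ∀ i, IsOpen (V i)) (hcov : ∀ x, ∃ i, x ∈ V i)
    (hloc : ∀ i j, ∀ x ∈ V i ∩ V j, ∀ᶠ y in 𝓝 x, (h j y)⁻¹ * h i y = (h j x)⁻¹ * h i x) :
    FiberBundleCore ι X G where
  baseSet := V
  isOpen_baseSet := hV
  indexAt x := (hcov x).choose
  mem_baseSet_at x := (hcov x).choose_spec
  coordChange i j x g := (h j x)⁻¹ * h i x * g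
  coordChange_self i x _ v := by simp
  coordChange_comp i j k x _ v := by group
  continuousOn_coordChange i j := by
    rintro ⟨x, g⟩ ⟨hx, -⟩
    refine ContinuousAt.continuousWithinAt ?_
    have : (fun p : X × G => (h j p.1)⁻¹ * h i p.1 * p.2) =ᶠ[𝓝 (x, g)]
        fun p => (h j x)⁻¹ * h i x * p.2 := by
      have := (continuous_fst.tendsto (x, g)).eventually (hloc i j x hx)
      filter_upwards [this] with p hp
      rw [hp]
    exact (continuousAt_congr this).2
      ((continuous_of_discreteTopology (f := fun g : G => (h j x)⁻¹ * h i x * g)).comp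
        continuous_snd).continuousAt

variable (hV : ∀ i, IsOpen (V i)) (hcov : ∀ x, ∃ i, x ∈ V i)
    (hloc : ∀ i j, ∀ x ∈ V i ∩ V j, ∀ᶠ y in 𝓝 x, (h j y)⁻¹ * h i y = (h j x)⁻¹ * h i x)

theorem isCoveringMap_jumpBundleCore : IsCoveringMap (jumpBundleCore hV hcov hloc).proj :=
  FiberBundle.isCoveringMap (F := G) (E := (jumpBundleCore hV hcov hloc).Fiber)

/-- The coordinate of a point of the total space which jumps along flat sections. -/
def jumpCoord (e : (jumpBundleCore hV hcov hloc).TotalSpace) : G :=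
  h ((jumpBundleCore hV hcov hloc).indexAt e.1) e.1 * (show G from e.2)

theorem jumpCoord_monodromy (i : ι) {x y : X} (γ : Path x y) (hγ : ∀ t, γ t ∈ V i)
    (e : (jumpBundleCore hV hcov hloc).proj ⁻¹' {x}) :
    jumpCoord hV hcov hloc ((isCoveringMap_jumpBundleCore hV hcov hloc).monodromy
      (Path.Homotopic.Quotient.mk γ) e).1 = h i y * (h i x)⁻¹ * jumpCoord hV hcov hloc e.1 := by
  obtain ⟨⟨x', f⟩, hx'⟩ := e
  obtain rfl : x' = x := hx'
  let Z := jumpBundleCore hV hcov hloc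
  let f₀ : G := Z.coordChange (Z.indexAt x') i x' f
  let Γ : I → Z.TotalSpace := fun t => ⟨γ t, Z.coordChange i (Z.indexAt (γ t)) (γ t) f₀⟩
  have hΓ : Continuous Γ := by
    have h1 : ContinuousOn (Z.localTriv i).toOpenPartialHomeomorph.symm
      (Z.localTriv i).target := (Z.localTriv i).continuousOn_invFun
    refine h1.comp_continuous (f := fun t => (γ t, f₀)) (by fun_prop) fun t => ?_
    rw [Z.mem_localTriv_target]
    exact hγ t
  have hΓe : Γ = (isCoveringMap_jumpBundleCore hV hcov hloc).liftPath γ ⟨x', f⟩ γ.source := by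
    rw [IsCoveringMap.eq_liftPath_iff]
    refine ⟨hΓ, rfl, ?_⟩
    have hx : x' ∈ V i := by simpa using hγ 0
    have : ∀ z, z = x' → (⟨z, Z.coordChange i (Z.indexAt z) z f₀⟩ : Z.TotalSpace) = ⟨x', f⟩ := by
      rintro z rfl
      congr 1
      exact (Z.coordChange_comp _ _ _ _ ⟨⟨Z.mem_baseSet_at _, hx⟩, Z.mem_baseSet_at _⟩ _).trans
        (Z.coordChange_self _ _ (Z.mem_baseSet_at _) _)
    exact this _ γ.source
  have h1 := congrFun hΓe 1
  change jumpCoord hV hcov hloc ((isCoveringMap_jumpBundleCore hV hcov hloc).liftPath γ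
    ⟨x', f⟩ γ.source 1) = _
  rw [← h1]
  have : ∀ z, z = y → jumpCoord hV hcov hloc ⟨z, Z.coordChange i (Z.indexAt z) z f₀⟩ =
      h i y * (h i x')⁻¹ * jumpCoord hV hcov hloc ⟨x', f⟩ := by
    rintro z rfl
    change h (Z.indexAt z) z * ((h (Z.indexAt z) z)⁻¹ * h i z *
      ((h i x')⁻¹ * h (Z.indexAt x') x' * (show G from f))) =
      h i z * (h i x')⁻¹ * (h (Z.indexAt x') x' * (show G from f))
    have aux : ∀ a b c d e : G, a * (a⁻¹ * b * (c⁻¹ * d * e)) = b * c⁻¹ * (d * e) := by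
      intros
      group
    exact aux _ _ _ _ _
  exact this _ γ.target

end Monodromy

section Cech

open Topology unitInterval

variable {X ι G : Type*} [TopologicalSpace X] {x₀ : X}

/-- The homotopy class of a path inside `W`. -/
def JoinedIn.homotopyClass {W : Set X} {x y : X} (H : JoinedIn W x y) :
    Path.Homotopic.Quotient x y :=
  .mk H.somePath

/-- Paths contained in `W` are determined up to homotopy in `X` by their endpoints. -/
def RelSimplyConnected (W : Set X) : Prop :=
  ∀ ⦃x y : X⦄ (γ γ' : Path x y), (∀ t, γ t ∈ W) → (∀ t, γ' t ∈ W) → γ.Homotopic γ'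

theorem RelSimplyConnected.homotopyClass_eq {W : Set X} (hW : RelSimplyConnected W) {x y : X}
    (H : JoinedIn W x y) (γ : Path x y) (hγ : ∀ t, γ t ∈ W) : H.homotopyClass = .mk γ :=
  Path.Homotopic.Quotient.eq.2 (hW _ _ H.somePath_mem hγ)

theorem RelSimplyConnected.homotopyClass_trans {W : Set X} (hW : RelSimplyConnected W) {x y z : X}
    (H : JoinedIn W x y) (H' : JoinedIn W y z) :
    H.homotopyClass.trans H'.homotopyClass = (H.trans H').homotopyClass := by
  rw [hW.homotopyClass_eq (H.trans H') (H.somePath.trans H'.somePath)]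
  · simp [JoinedIn.homotopyClass]
  · intro t
    have : H.somePath.trans H'.somePath t ∈ Set.range (H.somePath.trans H'.somePath) := ⟨t, rfl⟩
    rw [Path.trans_range] at this
    rcases this with ⟨s, hs⟩ | ⟨s, hs⟩
    · exact hs ▸ H.somePath_mem s
    · exact hs ▸ H'.somePath_mem s

theorem RelSimplyConnected.homotopyClass_mono {W W' : Set X} (hW' : RelSimplyConnected W')
    {x y : X} (H : JoinedIn W x y) (H' : JoinedIn W' x y) (h : W ⊆ W') :
    H.homotopyClass = H'.homotopyClass :=
  (hW'.homotopyClass_eq H' H.somePath fun t => h (H.somePath_mem t)).symm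

/-- The loop that goes from the base point to `x` inside `W` and comes back inside `W'`. -/
def bigonLoop {W W' : Set X} {x : X} (H : JoinedIn W x₀ x) (H' : JoinedIn W' x₀ x) :
    FundamentalGroup X x₀ :=
  H.homotopyClass.trans H'.homotopyClass.symm

variable [Group G] {V : ι → Set X} {h : ι → X → G} {φ : G →* FundamentalGroup X x₀}

open Path.Homotopic.Quotient in
/-- A homomorphism to the fundamental group is surjective if its range contains all the loops that
go out in one member of an open cover and come back in another one. -/
theorem surjective_of_bigonLoop_eq (hV : ∀ i, IsOpen (V i))
    (hcov : ∀ x, ∃ i, x ∈ V i) (hjoin : ∀ i, ∀ x ∈ V i, JoinedIn (V i) x₀ x)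
    (hsc : ∀ i, RelSimplyConnected (V i))
    (hφ : ∀ i j x (H : JoinedIn (V i) x₀ x) (H' : JoinedIn (V j) x₀ x),
      bigonLoop H H' = φ ((h j x)⁻¹ * h i x)) : Function.Surjective φ := by
  have key : ∀ {x y : X} (p : Path.Homotopic.Quotient x y), ∀ i j (H : JoinedIn (V i) x₀ x)
      (H' : JoinedIn (V j) x₀ y),
      (H.homotopyClass.trans (p.trans H'.homotopyClass.symm) : FundamentalGroup X x₀) ∈
        φ.range := by
    intro x y p
    induction p using Path.Homotopic.Quotient.induction_of_open_cover hV hcov with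
    | small k γ hγ =>
      intro i j H H'
      have Hx := hjoin k _ (by simpa using hγ 0)
      have Hy := hjoin k _ (by simpa using hγ 1)
      have e : Hx.homotopyClass.trans (.mk γ) = Hy.homotopyClass := by
        have : JoinedIn (V k) _ _ := ⟨γ, hγ⟩
        rw [← (hsc k).homotopyClass_eq this γ hγ, (hsc k).homotopyClass_trans]
      have : (H.homotopyClass.trans ((mk γ).trans H'.homotopyClass.symm) :
          FundamentalGroup X x₀) = bigonLoop Hy H' * bigonLoop H Hx := by
        have e' : H.homotopyClass.trans ((mk γ).trans H'.homotopyClass.symm) =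
            (H.homotopyClass.trans Hx.homotopyClass.symm).trans
              ((Hx.homotopyClass.trans (mk γ)).trans H'.homotopyClass.symm) := by
          grind
        rw [e] at e'
        exact e'
      rw [this, hφ, hφ]
      exact φ.range.mul_mem ⟨_, rfl⟩ ⟨_, rfl⟩
    | trans p q hp hq =>
      intro i j H H'
      obtain ⟨k, hk⟩ := hcov _
      have := φ.range.mul_mem (hq k j (hjoin k _ hk) H') (hp i k H (hjoin k _ hk))
      have e : (H.homotopyClass.trans (p.trans (hjoin k _ hk).homotopyClass.symm)).trans
          ((hjoin k _ hk).homotopyClass.trans (q.trans H'.homotopyClass.symm)) =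
            H.homotopyClass.trans ((p.trans q).trans H'.homotopyClass.symm) := by
        grind
      rw [← e]
      exact this
  intro p
  obtain ⟨i, hi⟩ := hcov x₀
  have H := hjoin i _ hi
  have hH : H.homotopyClass = Path.Homotopic.Quotient.refl x₀ :=
    (hsc i).homotopyClass_eq H (Path.refl x₀) fun t => hi
  have := key p i i H H
  rw [hH] at this
  have e : (refl x₀).trans (Path.Homotopic.Quotient.trans p (refl x₀).symm) = p := by
    have : (refl x₀).symm = refl x₀ := congrArg mk Path.refl_symm
    grind
  rw [e] at this
  exact this

/-- A homomorphism to the fundamental group is injective if it is undone, on generators, by the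
monodromy of the covering with transition functions `(h j)⁻¹ * h i`. -/
theorem injective_of_bigonLoop_eq (hV : ∀ i, IsOpen (V i))
    (hcov : ∀ x, ∃ i, x ∈ V i)
    (hloc : ∀ i j, ∀ x ∈ V i ∩ V j, ∀ᶠ y in 𝓝 x, (h j y)⁻¹ * h i y = (h j x)⁻¹ * h i x)
    (h₀ : ∀ i, h i x₀ = 1)
    (S : Set G) (hS : Subgroup.closure S = ⊤)
    (hφ : ∀ g ∈ S, ∃ i j x, ∃ (H : JoinedIn (V i) x₀ x) (H' : JoinedIn (V j) x₀ x),
      bigonLoop H H' = φ g ∧ g = (h j x)⁻¹ * h i x) : Function.Injective φ := by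
  let _ : TopologicalSpace G := ⊥
  have : DiscreteTopology G := ⟨rfl⟩
  have cov := isCoveringMap_jumpBundleCore hV hcov hloc
  have key : ∀ g : G, ∀ e, jumpCoord hV hcov hloc (cov.monodromyPerm x₀ (φ g) e).1 =
      g * jumpCoord hV hcov hloc e.1 := by
    intro g
    have hg : g ∈ Subgroup.closure S := hS ▸ Subgroup.mem_top g
    induction hg using Subgroup.closure_induction with
    | mem g hg =>
      intro e
      obtain ⟨i, j, x, H, H', hb, hgx⟩ := hφ g hg
      rw [← hb, IsCoveringMap.coe_monodromyPerm, bigonLoop, cov.monodromy_trans_apply,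
        JoinedIn.homotopyClass, JoinedIn.homotopyClass, ← Path.Homotopic.Quotient.mk_symm,
        jumpCoord_monodromy hV hcov hloc j H'.somePath.symm fun t => H'.somePath_mem _,
        jumpCoord_monodromy hV hcov hloc i _ H.somePath_mem, h₀, h₀, hgx]
      group
    | one =>
      intro e
      rw [map_one, map_one, Equiv.Perm.one_apply, one_mul]
    | mul a b _ _ ha hb =>
      intro e
      rw [map_mul, map_mul, Equiv.Perm.mul_apply, ha, hb, mul_assoc]
    | inv a _ ha =>
      intro e
      have := ha ((cov.monodromyPerm x₀ (φ a))⁻¹ e)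
      rw [← Equiv.Perm.mul_apply, mul_inv_cancel, Equiv.Perm.one_apply] at this
      rw [map_inv, map_inv, this, inv_mul_cancel_left]
  refine (injective_iff_map_eq_one φ).2 fun g hg => ?_
  have := key g ⟨⟨x₀, (1 : G)⟩, rfl⟩
  rw [hg, map_one, Equiv.Perm.one_apply] at this
  exact right_eq_mul.1 this

end Cech

section Matsumoto

open Equiv

variable {n : ℕ} {G : Type*} [Group G]

/-- The transposition of the neighbours `i` and `i + 1`. -/
def adjSwap (i : Fin n) : Perm (Fin (n + 1)) := swap i.castSucc i.succ

@[simp] theorem adjSwap_castSucc (i : Fin n) : adjSwap i i.castSucc = i.succ := swap_apply_left _ _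

@[simp] theorem adjSwap_succ (i : Fin n) : adjSwap i i.succ = i.castSucc := swap_apply_right _ _

theorem adjSwap_of_ne {i : Fin n} {x : Fin (n + 1)} (h : x ≠ i.castSucc) (h' : x ≠ i.succ) :
    adjSwap i x = x := swap_apply_of_ne_of_ne h h'

@[simp] theorem adjSwap_mul_self (i : Fin n) : adjSwap i * adjSwap i = 1 := swap_mul_self _ _

@[simp] theorem mul_adjSwap_mul_adjSwap (w : Perm (Fin (n + 1))) (i : Fin n) :
    w * adjSwap i * adjSwap i = w := by simp [mul_assoc]

@[simp] theorem adjSwap_inv (i : Fin n) : (adjSwap i)⁻¹ = adjSwap i := swap_inv _ _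

theorem val_adjSwap (i : Fin n) (x : Fin (n + 1)) : (adjSwap i x : ℕ) =
    if (x : ℕ) = i then (i : ℕ) + 1 else if (x : ℕ) = i + 1 then (i : ℕ) else x := by
  unfold adjSwap
  simp only [Equiv.swap_apply_def, Fin.ext_iff, Fin.val_castSucc, Fin.val_succ]
  split_ifs <;> rfl

theorem adjSwap_comm {i j : Fin n} (h : (i : ℕ) + 2 ≤ j) :
    adjSwap i * adjSwap j = adjSwap j * adjSwap i := by
  ext x
  simp only [Perm.mul_apply, val_adjSwap]
  split_ifs <;> omega

theorem adjSwap_braid {i j : Fin n} (h : (j : ℕ) = i + 1) :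
    adjSwap i * adjSwap j * adjSwap i = adjSwap j * adjSwap i * adjSwap j := by
  have e : i.succ = j.castSucc := Fin.ext (by simp [h])
  have hij : i.castSucc < j.castSucc := by simp [Fin.lt_def, h]
  have h1 := (hij.trans j.castSucc_lt_succ).ne
  unfold adjSwap
  rw [e, swap_mul_swap_mul_swap hij.ne h1, swap_comm i.castSucc, swap_comm j.castSucc j.succ,
    swap_mul_swap_mul_swap j.castSucc_lt_succ.ne' h1.symm, swap_comm]

theorem toLex_mul_adjSwap_lt {w : Perm (Fin (n + 1))} {i : Fin n} (h : w i.succ < w i.castSucc) :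
    toLex (⇑(w * adjSwap i)) < toLex ⇑w := by
  refine ⟨i.castSucc, fun j hj => ?_, by simpa using h⟩
  have : adjSwap i j = j := adjSwap_of_ne hj.ne (hj.trans i.castSucc_lt_succ).ne
  simp [this]

open scoped Classical in
/-- The product of the images of the letters of a reduced word of a permutation. -/
def reducedProd (σ : Fin n → G) (w : Perm (Fin (n + 1))) : G :=
  if h : ∃ i : Fin n, w i.succ < w i.castSucc then
    σ h.choose * reducedProd σ (w * adjSwap h.choose)
  else 1
termination_by WellFounded.wrap wellFounded_lt (toLex ⇑w)
decreasing_by exact toLex_mul_adjSwap_lt h.choose_spec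

theorem Equiv.Perm.eq_one_of_forall_castSucc_le {w : Perm (Fin (n + 1))}
    (h : ¬ ∃ i : Fin n, w i.succ < w i.castSucc) : w = 1 := by
  have : StrictMono w := Fin.strictMono_iff_lt_succ.2 fun i =>
    lt_of_le_of_ne (not_lt.1 fun hi => h ⟨i, hi⟩)
      (w.injective.ne i.castSucc_lt_succ.ne)
  have e := (this.range_inj strictMono_id).1 (by simp [w.surjective.range_eq])
  ext x
  simp [e]

theorem Equiv.Perm.induction_adjSwap {P : Perm (Fin (n + 1)) → Prop} (one : P 1)
    (mul : ∀ w (i : Fin n), w i.castSucc < w i.succ → P w → P (w * adjSwap i))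
    (w : Perm (Fin (n + 1))) : P w := by
  induction hw : toLex ⇑w using WellFoundedLT.induction generalizing w with
  | ind f ih =>
    subst hw
    by_cases h : ∃ i : Fin n, w i.succ < w i.castSucc
    · obtain ⟨i, hi⟩ := h
      have := mul (w * adjSwap i) i (by simpa using hi) (ih _ (toLex_mul_adjSwap_lt hi) _ rfl)
      simpa using this
    · rwa [Equiv.Perm.eq_one_of_forall_castSucc_le h]

theorem reducedProd_one (σ : Fin n → G) : reducedProd σ 1 = 1 := by
  unfold reducedProd
  rw [dif_neg]
  rintro ⟨i, hi⟩
  exact hi.not_gt i.castSucc_lt_succ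

variable {σ : Fin n → G} (hcomm : ∀ i j : Fin n, (i : ℕ) + 2 ≤ j → σ i * σ j = σ j * σ i)
  (hbraid : ∀ i j : Fin n, (j : ℕ) = i + 1 → σ i * σ j * σ i = σ j * σ i * σ j)

include hcomm hbraid

theorem reducedProd_of_succ_lt {w : Perm (Fin (n + 1))} {i : Fin n} (hi : w i.succ < w i.castSucc) :
    reducedProd σ w = σ i * reducedProd σ (w * adjSwap i) := by
  induction hw : toLex ⇑w using WellFoundedLT.induction generalizing w i with
  | ind f ih =>
    subst hw
    have far : ∀ {i j : Fin n}, w i.succ < w i.castSucc → w j.succ < w j.castSucc →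
        (i : ℕ) + 2 ≤ j → σ i * reducedProd σ (w * adjSwap i) =
          σ j * reducedProd σ (w * adjSwap j) := by
      intro i j hi hj hij
      have h1 : adjSwap i j.succ = j.succ :=
        adjSwap_of_ne (by simp [Fin.ext_iff]; omega) (by simp [Fin.ext_iff]; omega)
      have h2 : adjSwap i j.castSucc = j.castSucc :=
        adjSwap_of_ne (by simp [Fin.ext_iff]; omega) (by simp [Fin.ext_iff]; omega)
      have h3 : adjSwap j i.succ = i.succ :=
        adjSwap_of_ne (by simp [Fin.ext_iff]; omega) (by simp [Fin.ext_iff]; omega)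
      have h4 : adjSwap j i.castSucc = i.castSucc :=
        adjSwap_of_ne (by simp [Fin.ext_iff]; omega) (by simp [Fin.ext_iff]; omega)
      rw [ih _ (toLex_mul_adjSwap_lt hi) (i := j) (by simpa [h1, h2] using hj) rfl,
        ih _ (toLex_mul_adjSwap_lt hj) (i := i) (by simpa [h3, h4] using hi) rfl,
        mul_assoc w, mul_assoc w, adjSwap_comm hij, ← mul_assoc, ← mul_assoc, hcomm i j hij]
      simp only [mul_assoc]
    have near : ∀ {i j : Fin n}, w i.succ < w i.castSucc → w j.succ < w j.castSucc →
        (j : ℕ) = i + 1 → σ i * reducedProd σ (w * adjSwap i) =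
          σ j * reducedProd σ (w * adjSwap j) := by
      intro i j hi hj hij
      have e : i.succ = j.castSucc := Fin.ext (by simp [hij])
      have h1 : adjSwap i j.succ = j.succ :=
        adjSwap_of_ne (by simp [Fin.ext_iff]; omega) (by simp [Fin.ext_iff]; omega)
      have h2 : adjSwap i j.castSucc = i.castSucc := by rw [← e, adjSwap_succ]
      have h3 : adjSwap j i.succ = j.succ := by rw [e, adjSwap_castSucc]
      have h4 : adjSwap j i.castSucc = i.castSucc :=
        adjSwap_of_ne (by simp [Fin.ext_iff]; omega) (by simp [Fin.ext_iff]; omega)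
      have hi' : w j.castSucc < w i.castSucc := by rwa [← e]
      have hj' : w j.succ < w i.succ := by rwa [e]
      have hji : w j.succ < w i.castSucc := hj.trans hi'
      have hi1 := toLex_mul_adjSwap_lt hi
      have hj1 := toLex_mul_adjSwap_lt hj
      have hi2 : (w * adjSwap i) j.succ < (w * adjSwap i) j.castSucc := by
        rwa [Perm.mul_apply, Perm.mul_apply, h1, h2]
      have hj2 : (w * adjSwap j) i.succ < (w * adjSwap j) i.castSucc := by
        rwa [Perm.mul_apply, Perm.mul_apply, h3, h4]
      have hi3 : (w * adjSwap i * adjSwap j) i.succ < (w * adjSwap i * adjSwap j) i.castSucc := by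
        simpa only [Perm.mul_apply, h3, h4, h1, adjSwap_castSucc] using hj'
      have hj3 : (w * adjSwap j * adjSwap i) j.succ < (w * adjSwap j * adjSwap i) j.castSucc := by
        simpa only [Perm.mul_apply, h1, h2, h4, adjSwap_succ] using hi'
      rw [ih _ hi1 hi2 rfl, ih _ hj1 hj2 rfl,
        ih _ ((toLex_mul_adjSwap_lt hi2).trans hi1) hi3 rfl,
        ih _ ((toLex_mul_adjSwap_lt hj2).trans hj1) hj3 rfl]
      have e1 : w * adjSwap i * adjSwap j * adjSwap i = w * adjSwap j * adjSwap i * adjSwap j := by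
        simpa only [mul_assoc] using congrArg (w * ·) (adjSwap_braid hij)
      rw [e1]
      simp only [← mul_assoc]
      rw [hbraid i j hij]
    have h : ∃ i : Fin n, w i.succ < w i.castSucc := ⟨i, hi⟩
    rw [reducedProd, dif_pos h]
    have hj := h.choose_spec
    generalize h.choose = j at hj
    rcases lt_trichotomy (i : ℕ) j with hij | hij | hij
    · rcases (Nat.succ_le_of_lt hij).lt_or_eq with h2 | h2
      · exact (far hi hj h2).symm
      · exact (near hi hj h2.symm).symm
    · rw [Fin.ext hij]
    · rcases (Nat.succ_le_of_lt hij).lt_or_eq with h2 | h2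
      · exact far hj hi h2
      · exact near hj hi h2.symm

theorem reducedProd_mul_adjSwap {w : Perm (Fin (n + 1))} {i : Fin n}
    (hi : w i.castSucc < w i.succ) :
    reducedProd σ (w * adjSwap i) = σ i * reducedProd σ w := by
  rw [reducedProd_of_succ_lt hcomm hbraid (i := i) (by simpa using hi), mul_adjSwap_mul_adjSwap]

theorem reducedProd_adjSwap (i : Fin n) : reducedProd σ (adjSwap i) = σ i := by
  have := reducedProd_mul_adjSwap hcomm hbraid (w := 1) (i := i) i.castSucc_lt_succ
  rwa [one_mul, reducedProd_one, mul_one] at this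

/-- The product over reduced words is multiplicative on products of permutations whose
lengths add up. -/
theorem reducedProd_mul {u v : Perm (Fin (n + 1))}
    (h : ∀ p q, p < q → v⁻¹ q < v⁻¹ p → u p < u q) :
    reducedProd σ (u * v) = reducedProd σ v * reducedProd σ u := by
  induction v using Equiv.Perm.induction_adjSwap with
  | one => simp [reducedProd_one]
  | mul v i hi ih =>
    rw [← mul_assoc, reducedProd_mul_adjSwap hcomm hbraid, reducedProd_mul_adjSwap hcomm hbraid hi,
      ih, mul_assoc]
    · intro p q hpq hvpq
      refine h p q hpq ?_
      by_contra hcon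
      simp only [mul_inv_rev, adjSwap_inv, Perm.mul_apply] at hcon
      have h1 := val_adjSwap i (v⁻¹ p)
      have h2 := val_adjSwap i (v⁻¹ q)
      have h3 : v⁻¹ q = i.castSucc ∧ v⁻¹ p = i.succ := by
        simp only [Fin.ext_iff, Fin.val_castSucc, Fin.val_succ]
        rw [Fin.lt_def] at hvpq hcon
        split_ifs at h1 h2 <;> omega
      rw [← h3.1, ← h3.2] at hi
      have hv : ∀ x, v (v⁻¹ x) = x := v.apply_symm_apply
      rw [hv, hv] at hi
      exact hi.not_gt hpq
    · exact h _ _ hi (by simp)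

omit hcomm hbraid in
theorem braid_relations_of_mul_adjSwap {H : Type*} [Group H] (L : Perm (Fin (n + 1)) → H)
    (hL : ∀ u (i : Fin n), u i.castSucc < u i.succ → L (u * adjSwap i) = L (adjSwap i) * L u) :
    (∀ i j : Fin n, (i : ℕ) + 2 ≤ j →
      L (adjSwap i) * L (adjSwap j) = L (adjSwap j) * L (adjSwap i)) ∧
    (∀ i j : Fin n, (j : ℕ) = i + 1 → L (adjSwap i) * L (adjSwap j) * L (adjSwap i) =
      L (adjSwap j) * L (adjSwap i) * L (adjSwap j)) := by
  refine ⟨fun i j hij => ?_, fun i j hij => ?_⟩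
  · rw [← hL, ← hL, adjSwap_comm hij]
    · simp only [Fin.lt_def, val_adjSwap, Fin.val_castSucc, Fin.val_succ]
      split_ifs <;> omega
    · simp only [Fin.lt_def, val_adjSwap, Fin.val_castSucc, Fin.val_succ]
      split_ifs <;> omega
  · rw [mul_assoc, mul_assoc, ← hL, ← hL, ← hL, ← hL, adjSwap_braid hij]
    all_goals
      simp only [Fin.lt_def, Perm.mul_apply, val_adjSwap, Fin.val_castSucc, Fin.val_succ]
      split_ifs <;> omega

end Matsumoto

section BraidGroup

open Equiv

variable {n : ℕ}

/-- The Artin generators, indexed from zero. -/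
def braidGen (i : Fin n) : BraidGroup (n + 1) :=
  PresentedGroup.of (rels := braidRels (n + 1)) i

theorem braidGen_comm (i j : Fin n) (h : (i : ℕ) + 2 ≤ j) :
    braidGen i * braidGen j = braidGen j * braidGen i := by
  have := PresentedGroup.mk_eq_one_iff.2 (Subgroup.subset_normalClosure
    (s := braidRels (n + 1)) (Or.inl ⟨i, j, h, rfl⟩))
  rw [map_mul, map_mul, map_mul, map_inv, map_inv, mul_inv_eq_one, mul_inv_eq_iff_eq_mul] at this
  exact this

theorem braidGen_braid (i j : Fin n) (h : (j : ℕ) = i + 1) :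
    braidGen i * braidGen j * braidGen i = braidGen j * braidGen i * braidGen j := by
  have := PresentedGroup.mk_eq_one_iff.2 (Subgroup.subset_normalClosure
    (s := braidRels (n + 1)) (Or.inr ⟨i, j, h, rfl⟩))
  rw [map_mul, map_inv, mul_inv_eq_one] at this
  simp only [map_mul] at this
  exact this

theorem closure_range_braidGen :
    Subgroup.closure (Set.range (braidGen : Fin n → BraidGroup (n + 1))) = ⊤ :=
  PresentedGroup.closure_range_of (braidRels (n + 1))

/-- The positive lift of a permutation to the braid group. -/
def posLift (w : Perm (Fin (n + 1))) : BraidGroup (n + 1) := reducedProd braidGen w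

@[simp] theorem posLift_one : posLift (1 : Perm (Fin (n + 1))) = 1 := reducedProd_one _

theorem posLift_adjSwap (i : Fin n) : posLift (adjSwap i) = braidGen i :=
  reducedProd_adjSwap braidGen_comm braidGen_braid i

theorem posLift_mul {u v : Perm (Fin (n + 1))}
    (h : ∀ p q, p < q → v⁻¹ q < v⁻¹ p → u p < u q) :
    posLift (u * v) = posLift v * posLift u :=
  reducedProd_mul braidGen_comm braidGen_braid h

theorem exists_monoidHom_posLift {H : Type*} [Group H] (L : Perm (Fin (n + 1)) → H)
    (h1 : L 1 = 1)
    (hL : ∀ u (i : Fin n), u i.castSucc < u i.succ → L (u * adjSwap i) = L (adjSwap i) * L u) :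
    ∃ φ : BraidGroup (n + 1) →* H, ∀ u, φ (posLift u) = L u := by
  obtain ⟨hc, hb⟩ := braid_relations_of_mul_adjSwap L hL
  let f : Fin n → H := fun i => L (adjSwap i)
  have hrel : ∀ r ∈ braidRels (n + 1), FreeGroup.lift (β := H) (α := Fin n) f r = 1 := by
    rintro r (⟨i, j, h, rfl⟩ | ⟨i, j, h, rfl⟩)
    · simp only [map_mul, map_inv, FreeGroup.lift_apply_of]
      rw [mul_inv_eq_one, mul_inv_eq_iff_eq_mul]
      exact hc i j h
    · rw [map_mul, map_inv, mul_inv_eq_one]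
      simp only [map_mul, FreeGroup.lift_apply_of]
      exact hb i j h
  let φ : BraidGroup (n + 1) →* H := PresentedGroup.toGroup (rels := braidRels (n + 1)) hrel
  have hφ : ∀ i : Fin n, φ (braidGen i) = L (adjSwap i) := fun i =>
    PresentedGroup.toGroup.of (rels := braidRels (n + 1)) hrel
  refine ⟨φ, fun u => ?_⟩
  induction u using Equiv.Perm.induction_adjSwap with
  | one => rw [posLift_one, map_one, h1]
  | mul w i hi ih =>
    rw [hL w i hi, ← ih, ← hφ, ← map_mul]
    exact congrArg φ (reducedProd_mul_adjSwap braidGen_comm braidGen_braid hi)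

end BraidGroup

section Roots

variable {m : ℕ}

/-- The non-leading coefficients of the monic polynomial with the given roots. -/
def coeffsOfRoots (z : Fin m → ℂ) : Fin m → ℂ := fun i => (∏ j, (X - C (z j))).coeff i

theorem Polynomial.continuous_coeff_prod_X_sub_C {ι R : Type*} [CommRing R] [TopologicalSpace R]
    [IsTopologicalRing R] (s : Finset ι) (k : ℕ) :
    Continuous fun z : ι → R => (∏ j ∈ s, (X - C (z j))).coeff k := by
  classical
  induction s using Finset.induction_on generalizing k with
  | empty => simpa using continuous_const
  | insert a s ha ih =>
    simp only [Finset.prod_insert ha]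
    cases k with
    | zero => simp only [mul_coeff_zero, coeff_sub, coeff_X_zero, coeff_C_zero]; fun_prop
    | succ k => simp only [sub_mul, coeff_sub, coeff_X_mul, coeff_C_mul]; fun_prop

theorem continuous_coeffsOfRoots : Continuous (coeffsOfRoots (m := m)) :=
  continuous_pi fun i => Polynomial.continuous_coeff_prod_X_sub_C Finset.univ (i : ℕ)

theorem Polynomial.Monic.eq_polyOf {p : ℂ[X]} (hp : p.Monic) (hm : p.natDegree = m) :
    polyOf m (fun i => p.coeff i) = p := by
  conv_rhs => rw [hp.as_sum, hm, Finset.sum_range]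
  rfl

theorem polyOf_coeffsOfRoots (z : Fin m → ℂ) :
    polyOf m (coeffsOfRoots z) = ∏ j, (X - C (z j)) :=
  (monic_prod_of_monic _ _ fun j _ => monic_X_sub_C (z j)).eq_polyOf (by simp)

theorem polyOf_eq_add_degree_lt (a : Fin m → ℂ) :
    ∃ r : ℂ[X], polyOf m a = X ^ m + r ∧ r.degree < m ∧ ∀ i : Fin m, r.coeff i = a i := by
  refine ⟨_, rfl, ?_, fun i => ?_⟩
  · refine (degree_sum_le _ _).trans_lt ((Finset.sup_lt_iff (WithBot.bot_lt_coe m)).2 fun i _ => ?_)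
    exact (degree_C_mul_X_pow_le _ _).trans_lt (WithBot.coe_lt_coe.2 i.2)
  · simp [coeff_X_pow, Fin.val_inj]

theorem monic_polyOf (a : Fin m → ℂ) : (polyOf m a).Monic := by
  obtain ⟨r, h, hr, -⟩ := polyOf_eq_add_degree_lt a
  rw [h]
  exact monic_X_pow_add hr

theorem natDegree_polyOf (a : Fin m → ℂ) : (polyOf m a).natDegree = m := by
  obtain ⟨r, h, hr, -⟩ := polyOf_eq_add_degree_lt a
  rw [h, add_comm, natDegree_add_eq_right_of_degree_lt (by simpa using hr), natDegree_X_pow]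

theorem coeff_polyOf (a : Fin m → ℂ) (i : Fin m) : (polyOf m a).coeff i = a i := by
  obtain ⟨r, h, -, hr⟩ := polyOf_eq_add_degree_lt a
  simp [h, hr, coeff_X_pow, i.2.ne]

theorem polyOf_injective : Function.Injective (polyOf m) := fun a b h =>
  funext fun i => by rw [← coeff_polyOf a, h, coeff_polyOf]

theorem squarefree_polyOf_coeffsOfRoots {z : Fin m → ℂ} :
    Squarefree (polyOf m (coeffsOfRoots z)) ↔ Function.Injective z := by
  rw [← PerfectField.separable_iff_squarefree, polyOf_coeffsOfRoots, separable_prod_X_sub_C_iff]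

theorem Multiset.exists_fin_prod_eq {α M : Type*} [CommMonoid M] (s : Multiset α) (f : α → M)
    (hs : s.card = m) : ∃ z : Fin m → α, (s.map f).prod = ∏ j, f (z j) := by
  induction s using Quotient.inductionOn with
  | h l =>
    obtain rfl : l.length = m := hs
    exact ⟨l.get, by simp⟩

theorem coeffsOfRoots_surjective : Function.Surjective (coeffsOfRoots (m := m)) := by
  intro a
  have hs := IsAlgClosed.splits (polyOf m a)
  obtain ⟨z, hz⟩ := (polyOf m a).roots.exists_fin_prod_eq (fun x => X - C x)
    (hs.natDegree_eq_card_roots.symm.trans (natDegree_polyOf a))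
  exact ⟨z, polyOf_injective (by
    rw [polyOf_coeffsOfRoots, ← hz, ← hs.eq_prod_roots_of_monic (monic_polyOf a)])⟩

theorem isProperMap_coeffsOfRoots : IsProperMap (coeffsOfRoots (m := m)) := by
  rw [isProperMap_iff_isCompact_preimage]
  refine ⟨continuous_coeffsOfRoots, fun K hK => ?_⟩
  obtain ⟨R, hR⟩ := hK.isBounded.exists_norm_le
  refine Metric.isCompact_of_isClosed_isBounded (hK.isClosed.preimage continuous_coeffsOfRoots) ?_
  refine isBounded_iff_forall_norm_le.2 ⟨R + 1, fun z hz => ?_⟩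
  have h0 : 0 ≤ R := (norm_nonneg _).trans (hR _ hz)
  refine (pi_norm_le_iff_of_nonneg (by positivity)).2 fun j => ?_
  have hroot : (polyOf m (coeffsOfRoots z)).IsRoot (z j) := by
    rw [polyOf_coeffsOfRoots, isRoot_prod]
    exact ⟨j, Finset.mem_univ _, root_X_sub_C.2 rfl⟩
  refine (NNReal.coe_le_coe.2 (hroot.norm_lt_cauchyBound (monic_polyOf _).ne_zero).le).trans ?_
  rw [cauchyBound, (monic_polyOf _).leadingCoeff, natDegree_polyOf]
  simp only [nnnorm_one, div_one, NNReal.coe_add, NNReal.coe_one, add_le_add_iff_right]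
  lift R to NNReal using h0
  refine NNReal.coe_le_coe.2 (Finset.sup_le fun i hi => ?_)
  have := (norm_le_pi_norm (coeffsOfRoots z) ⟨i, Finset.mem_range.1 hi⟩).trans (hR _ hz)
  rw [← coeff_polyOf (coeffsOfRoots z)] at this
  exact this

theorem exists_perm_of_coeffsOfRoots_eq {z z' : Fin m → ℂ} (hz : Function.Injective z)
    (h : coeffsOfRoots z = coeffsOfRoots z') : ∃ w : Equiv.Perm (Fin m), z' = z ∘ w := by
  have hz' : Function.Injective z' := by
    rwa [← squarefree_polyOf_coeffsOfRoots, ← h, squarefree_polyOf_coeffsOfRoots]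
  have hr : ∀ z : Fin m → ℂ, Set.range z = {x | (polyOf m (coeffsOfRoots z)).IsRoot x} := by
    intro z
    ext x
    rw [polyOf_coeffsOfRoots]
    refine Iff.trans ?_ (isRoot_prod Finset.univ (fun j => X - C (z j)) x).symm
    simp [sub_eq_zero, eq_comm]
  have e : Set.range z' = Set.range z := by rw [hr, hr, h]
  refine ⟨(Equiv.ofInjective z' hz').trans
    ((Equiv.setCongr e).trans (Equiv.ofInjective z hz).symm), funext fun j => ?_⟩
  simp [Equiv.apply_ofInjective_symm]

theorem coeffsOfRoots_comp_perm (z : Fin m → ℂ) (w : Equiv.Perm (Fin m)) :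
    coeffsOfRoots (z ∘ w) = coeffsOfRoots z := by
  refine polyOf_injective ?_
  rw [polyOf_coeffsOfRoots, polyOf_coeffsOfRoots]
  exact Equiv.prod_comp w fun j => X - C (z j)

variable (m) in
/-- Ordered configurations of `m` distinct complex numbers. -/
abbrev Conf : Type := {z : Fin m → ℂ // Function.Injective z}

/-- The polynomial with a given set of simple roots. -/
def Conf.toUPoly (z : Conf m) : UPoly m :=
  ⟨coeffsOfRoots z.1, squarefree_polyOf_coeffsOfRoots.2 z.2⟩

/-- Relabelling the points of a configuration. -/
def Conf.relabel (z : Conf m) (w : Equiv.Perm (Fin m)) : Conf m := ⟨z.1 ∘ w, z.2.comp w.injective⟩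

@[simp] theorem Conf.toUPoly_relabel (z : Conf m) (w : Equiv.Perm (Fin m)) :
    (z.relabel w).toUPoly = z.toUPoly :=
  Subtype.ext (coeffsOfRoots_comp_perm z.1 w)

theorem Conf.exists_relabel_eq {z z' : Conf m} (h : z.toUPoly = z'.toUPoly) :
    ∃ w, z' = z.relabel w := by
  obtain ⟨w, hw⟩ := exists_perm_of_coeffsOfRoots_eq z.2 (congrArg Subtype.val h)
  exact ⟨w, Subtype.ext hw⟩

theorem Conf.toUPoly_surjective : Function.Surjective (Conf.toUPoly (m := m)) := by
  rintro ⟨a, ha⟩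
  obtain ⟨z, rfl⟩ := coeffsOfRoots_surjective a
  exact ⟨⟨z, squarefree_polyOf_coeffsOfRoots.1 ha⟩, rfl⟩

theorem Conf.continuous_toUPoly : Continuous (Conf.toUPoly (m := m)) :=
  (continuous_coeffsOfRoots.comp continuous_subtype_val).subtype_mk _

theorem isOpen_setOf_injective : IsOpen {z : Fin m → ℂ | Function.Injective z} := by
  have : {z : Fin m → ℂ | Function.Injective z} =
      ⋂ a, ⋂ b, {z : Fin m → ℂ | a ≠ b → z a ≠ z b} := by
    ext z
    simp only [Set.mem_ofPred_eq, Set.mem_iInter]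
    exact ⟨fun h a b hab => h.ne hab, fun h a b hab => not_imp_comm.1 (h a b) (by simpa using hab)⟩
  rw [this]
  refine isOpen_iInter_of_finite fun a => isOpen_iInter_of_finite fun b => ?_
  by_cases hab : a = b
  · simp [hab]
  · simpa [hab] using isOpen_ne_fun (continuous_apply a) (continuous_apply b)

theorem Conf.isOpenMap_toUPoly : IsOpenMap (Conf.toUPoly (m := m)) := by
  intro U hU
  have hQ := isProperMap_coeffsOfRoots (m := m).isClosedMap.isQuotientMap
    continuous_coeffsOfRoots coeffsOfRoots_surjective
  have hV := isOpen_setOf_injective.isOpenMap_subtype_val U hU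
  have : IsOpen (coeffsOfRoots '' (Subtype.val '' U)) := by
    rw [← hQ.isOpen_preimage]
    have : coeffsOfRoots ⁻¹' (coeffsOfRoots '' (Subtype.val '' U)) =
        ⋃ w : Equiv.Perm (Fin m), (fun z : Fin m → ℂ => z ∘ w) ⁻¹' (Subtype.val '' U) := by
      ext z
      simp only [Set.mem_iUnion]
      constructor
      · rintro ⟨_, ⟨z', hz', rfl⟩, h⟩
        obtain ⟨w, hw⟩ := exists_perm_of_coeffsOfRoots_eq z'.2 h
        refine ⟨w⁻¹, z', hz', ?_⟩
        ext j
        simp [hw]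
      · rintro ⟨w, hw⟩
        exact ⟨_, hw, coeffsOfRoots_comp_perm z w⟩
    rw [this]
    exact isOpen_iUnion fun w => hV.preimage (by fun_prop)
  have e : Conf.toUPoly '' U = Subtype.val ⁻¹' (coeffsOfRoots '' (Subtype.val '' U)) := by
    ext x
    constructor
    · rintro ⟨z, hz, rfl⟩
      exact ⟨z.1, ⟨z, hz, rfl⟩, rfl⟩
    · rintro ⟨_, ⟨z, hz, rfl⟩, h⟩
      exact ⟨z, hz, Subtype.ext h⟩
  rw [e]
  exact this.preimage continuous_subtype_val

end Roots

section Bigon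

open Topology

variable {X Y : Type*} [TopologicalSpace X] [TopologicalSpace Y] {x₀ : X}

theorem Topology.IsEmbedding.relSimplyConnected_range [SimplyConnectedSpace Y] {f : Y → X}
    (hf : IsEmbedding f) : RelSimplyConnected (Set.range f) := by
  have lift : ∀ {a b : Y} (γ : Path (f a) (f b)), (∀ t, γ t ∈ Set.range f) →
      ∃ δ : Path a b, δ.map hf.continuous = γ := by
    intro a b γ hγ
    choose g hg using hγ
    refine ⟨⟨⟨g, ?_⟩, hf.injective ?_, hf.injective ?_⟩, ?_⟩
    · rw [hf.continuous_iff]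
      convert γ.continuous using 1
      exact funext hg
    · exact (hg 0).trans γ.source
    · exact (hg 1).trans γ.target
    · ext t
      exact hg t
  intro x y γ γ' hγ hγ'
  obtain ⟨a, rfl⟩ : x ∈ Set.range f := by simpa using hγ 0
  obtain ⟨b, rfl⟩ : y ∈ Set.range f := by simpa using hγ 1
  obtain ⟨δ, rfl⟩ := lift γ hγ
  obtain ⟨δ', rfl⟩ := lift γ' hγ'
  exact (SimplyConnectedSpace.paths_homotopic δ δ').map ⟨f, hf.continuous⟩

variable {W W' W'' : Set X} {x y : X}

theorem Path.Homotopic.Quotient.trans_symm_rev {a b c : X} (p : Path.Homotopic.Quotient a b)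
    (q : Path.Homotopic.Quotient b c) : (p.trans q).symm = q.symm.trans p.symm := by
  induction p using Path.Homotopic.Quotient.ind
  induction q using Path.Homotopic.Quotient.ind
  exact congrArg Path.Homotopic.Quotient.mk (Path.trans_symm _ _)

theorem bigonLoop_mul (H : JoinedIn W x₀ x) (H' : JoinedIn W' x₀ x) (H'' : JoinedIn W'' x₀ x) :
    bigonLoop H' H'' * bigonLoop H H' = bigonLoop H H'' := by
  have : (H.homotopyClass.trans H'.homotopyClass.symm).trans
      (H'.homotopyClass.trans H''.homotopyClass.symm) =
        H.homotopyClass.trans H''.homotopyClass.symm := by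
    grind
  exact this

theorem bigonLoop_self (H : JoinedIn W x₀ x) : bigonLoop H H = 1 :=
  mul_eq_left.1 (bigonLoop_mul H H H)

theorem bigonLoop_inv (H : JoinedIn W x₀ x) (H' : JoinedIn W' x₀ x) :
    (bigonLoop H H')⁻¹ = bigonLoop H' H :=
  inv_eq_of_mul_eq_one_left (by rw [bigonLoop_mul, bigonLoop_self])

theorem bigonLoop_eq_of_joinedIn (hW : RelSimplyConnected W) (hW' : RelSimplyConnected W')
    (J : JoinedIn (W ∩ W') x y) (H : JoinedIn W x₀ x) (H' : JoinedIn W' x₀ x)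
    (K : JoinedIn W x₀ y) (K' : JoinedIn W' x₀ y) : bigonLoop H H' = bigonLoop K K' := by
  have h1 := hW.homotopyClass_trans H (J.mono Set.inter_subset_left)
  have h2 := hW'.homotopyClass_trans H' (J.mono Set.inter_subset_right)
  have h3 := hW.homotopyClass_mono J (J.mono Set.inter_subset_left) Set.inter_subset_left
  have h4 := hW'.homotopyClass_mono J (J.mono Set.inter_subset_right) Set.inter_subset_right
  have : H.homotopyClass.trans H'.homotopyClass.symm =
      (H.homotopyClass.trans J.homotopyClass).trans
        (H'.homotopyClass.trans J.homotopyClass).symm := by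
    rw [Path.Homotopic.Quotient.trans_symm_rev]
    grind
  rw [h3, h1] at this
  rw [← h3, h4, h2] at this
  exact this

theorem bigonLoop_eq_one (hW : RelSimplyConnected W) (hW' : RelSimplyConnected W')
    (J : JoinedIn (W ∩ W') x₀ x) (H : JoinedIn W x₀ x) (H' : JoinedIn W' x₀ x) :
    bigonLoop H H' = 1 := by
  have h0 : x₀ ∈ W ∩ W' := J.source_mem
  have hr : ∀ {U : Set X} (hU : RelSimplyConnected U) (h : x₀ ∈ U),
      (JoinedIn.refl h).homotopyClass = Path.Homotopic.Quotient.refl x₀ := fun hU h =>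
    hU.homotopyClass_eq _ (Path.refl x₀) fun _ => h
  rw [← bigonLoop_eq_of_joinedIn hW hW' J (JoinedIn.refl h0.1) (JoinedIn.refl h0.2)]
  unfold bigonLoop
  rw [hr hW h0.1, hr hW' h0.2]
  have e : (Path.Homotopic.Quotient.refl x₀).symm = Path.Homotopic.Quotient.refl x₀ :=
    congrArg Path.Homotopic.Quotient.mk Path.refl_symm
  rw [e]
  exact Path.Homotopic.Quotient.trans_refl _

end Bigon

section Charts

open Topology

variable {m : ℕ}

/-- The configurations in which points with smaller label are to the left, and points with the
same label are ordered by height. -/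
def chartSet (c : Fin m →o ℝ) : Set (Fin m → ℂ) :=
  {z | ∀ a b, a < b → (c a < c b → (z a).re < (z b).re) ∧ (c a = c b → (z a).im < (z b).im)}

theorem isOpen_chartSet (c : Fin m →o ℝ) : IsOpen (chartSet c) := by
  rw [isOpen_iff_eventually]
  intro z hz
  simp only [chartSet, Set.mem_ofPred_eq, Filter.eventually_all,
    Filter.eventually_and]
  intro a b hab
  refine ⟨fun h => ?_, fun h => ?_⟩
  · exact ((Complex.continuous_re.comp (continuous_apply a)).tendsto z).eventually_lt
      ((Complex.continuous_re.comp (continuous_apply b)).tendsto z) ((hz a b hab).1 h)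
  · exact ((Complex.continuous_im.comp (continuous_apply a)).tendsto z).eventually_lt
      ((Complex.continuous_im.comp (continuous_apply b)).tendsto z) ((hz a b hab).2 h)

theorem convex_chartSet (c : Fin m →o ℝ) : Convex ℝ (chartSet c) := by
  have aux : ∀ {s t x y x' y' : ℝ}, 0 ≤ s → 0 ≤ t → s + t = 1 → x < y → x' < y' →
      s * x + t * x' < s * y + t * y' := by
    intro s t x y x' y' hs ht hst h h'
    rcases hs.eq_or_lt with rfl | hs
    · obtain rfl : t = 1 := by linarith
      linarith
    · nlinarith
  intro z hz z' hz' s t hs ht hst a b hab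
  have h1 := hz a b hab
  have h2 := hz' a b hab
  refine ⟨fun h => ?_, fun h => ?_⟩
  · simpa using aux hs ht hst (h1.1 h) (h2.1 h)
  · simpa using aux hs ht hst (h1.2 h) (h2.2 h)

theorem injective_of_mem_chartSet {c : Fin m →o ℝ} {z : Fin m → ℂ} (hz : z ∈ chartSet c) :
    Function.Injective z := by
  refine .of_lt_imp_ne fun a b hab e => ?_
  rcases (c.monotone hab.le).lt_or_eq with h | h
  · exact ((hz a b hab).1 h).ne (by rw [e])
  · exact ((hz a b hab).2 h).ne (by rw [e])

variable (m) in
/-- The points `0, 1 + i, 2 + 2 * i, …`. -/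
def diagPoint : Fin m → ℂ := fun a => ⟨a, a⟩

theorem diagPoint_mem_chartSet (c : Fin m →o ℝ) : diagPoint m ∈ chartSet c := fun a b hab => by
  have : (a : ℝ) < b := by exact_mod_cast hab
  exact ⟨fun _ => this, fun _ => this⟩

theorem label_le_of_re_lt {c : Fin m →o ℝ} {z : Fin m → ℂ} (hz : z ∈ chartSet c) {a b : Fin m}
    (h : (z a).re < (z b).re) : c a ≤ c b := by
  by_contra! hc
  exact ((hz b a (c.monotone.reflect_lt hc)).1 hc).not_gt h

theorem eq_one_of_comp_mem_chartSet {c : Fin m →o ℝ} {z : Fin m → ℂ} (hz : z ∈ chartSet c)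
    {w : Equiv.Perm (Fin m)} (hzw : z ∘ w ∈ chartSet c) : w = 1 := by
  have hle : ∀ a, c a ≤ c (w a) := by
    intro a
    by_contra! ha
    have hmaps : ∀ b, c b < c a → c (w b) < c a := fun b hb =>
      (label_le_of_re_lt hz ((hzw b a (c.monotone.reflect_lt hb)).1 hb)).trans_lt ha
    have hsurj := Finset.surj_on_of_inj_on_of_card_le (s := {b | c b < c a}) (t := {b | c b < c a})
      (fun b _ => w b) (by simpa using hmaps) (fun _ _ _ _ e => w.injective e) le_rfl (w a)
      (by simpa using ha)
    obtain ⟨b, hb, hba⟩ := hsurj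
    rw [w.injective hba] at ha
    simp [w.injective hba] at hb
  have heq : ∀ a, c a = c (w a) := by
    have := (Finset.sum_eq_sum_iff_of_le fun a (_ : a ∈ Finset.univ) => hle a).1
      (Equiv.sum_comp w c).symm
    exact fun a => this a (Finset.mem_univ a)
  have hmono : StrictMono w := by
    intro a b hab
    rcases (c.monotone hab.le).lt_or_eq with h | h
    · rw [heq a, heq b] at h
      exact c.monotone.reflect_lt h
    · have h1 := (hzw a b hab).2 h
      rw [heq a, heq b] at h
      refine lt_of_le_of_ne (not_lt.1 fun h2 => ?_) (w.injective.ne hab.ne)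
      exact ((hz _ _ h2).2 h.symm).not_gt h1
  have e := (hmono.range_inj strictMono_id).1 (by simp [w.surjective.range_eq])
  ext x
  simp [e]

/-- A chart of the space of squarefree monic polynomials. -/
def chartMap (c : Fin m →o ℝ) (z : chartSet c) : UPoly m :=
  Conf.toUPoly ⟨z.1, injective_of_mem_chartSet z.2⟩

theorem isOpenEmbedding_chartMap (c : Fin m →o ℝ) : IsOpenEmbedding (chartMap c) := by
  refine .of_continuous_injective_isOpenMap ?_ ?_ ?_
  · exact Conf.continuous_toUPoly.comp (continuous_subtype_val.subtype_mk _)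
  · intro z z' h
    obtain ⟨w, hw⟩ := Conf.exists_relabel_eq h
    have hw : z'.1 = z.1 ∘ w := congrArg Subtype.val hw
    have := eq_one_of_comp_mem_chartSet z.2 (hw ▸ z'.2)
    exact Subtype.ext (by simp [hw, this])
  · refine Conf.isOpenMap_toUPoly.comp (g := Conf.toUPoly) (f := fun z : chartSet c =>
      (⟨z.1, injective_of_mem_chartSet z.2⟩ : Conf m)) ?_
    refine IsOpenEmbedding.isOpenMap (IsOpenEmbedding.of_comp _
      isOpen_setOf_injective.isOpenEmbedding_subtypeVal ?_)
    exact (isOpen_chartSet c).isOpenEmbedding_subtypeVal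

/-- The domain of a chart. -/
def chart (c : Fin m →o ℝ) : Set (UPoly m) := Set.range (chartMap c)

theorem isOpen_chart (c : Fin m →o ℝ) : IsOpen (chart c) :=
  (isOpenEmbedding_chartMap c).isOpen_range

instance (c : Fin m →o ℝ) : ContractibleSpace (chartSet c) :=
  (convex_chartSet c).contractibleSpace ⟨_, diagPoint_mem_chartSet c⟩

theorem relSimplyConnected_chart (c : Fin m →o ℝ) : RelSimplyConnected (chart c) :=
  (isOpenEmbedding_chartMap c).isEmbedding.relSimplyConnected_range

theorem isPathConnected_chart (c : Fin m →o ℝ) : IsPathConnected (chart c) :=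
  isPathConnected_range (isOpenEmbedding_chartMap c).continuous

theorem Conf.toUPoly_mem_chart {c : Fin m →o ℝ} (z : Conf m) (w : Equiv.Perm (Fin m))
    (hz : z.1 ∘ w ∈ chartSet c) : z.toUPoly ∈ chart c :=
  ⟨⟨_, hz⟩, z.toUPoly_relabel w⟩

theorem Conf.joinedIn_chart_inter_chart {c d : Fin m →o ℝ} {z z' : Conf m} (w : Equiv.Perm (Fin m))
    (hz : z.1 ∈ chartSet c) (hz' : z'.1 ∈ chartSet c) (hzw : z.1 ∘ w ∈ chartSet d)
    (hzw' : z'.1 ∘ w ∈ chartSet d) : JoinedIn (chart c ∩ chart d) z.toUPoly z'.toUPoly := by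
  have hconv : Convex ℝ (chartSet c ∩ (LinearMap.funLeft ℝ ℂ w) ⁻¹' chartSet d) :=
    (convex_chartSet c).inter ((convex_chartSet d).linear_preimage _)
  obtain ⟨γ, hγ⟩ := (hconv.isPathConnected ⟨z.1, hz, hzw⟩).joinedIn z.1 ⟨hz, hzw⟩ z'.1 ⟨hz', hzw'⟩
  refine ⟨⟨⟨fun t => Conf.toUPoly ⟨γ t, injective_of_mem_chartSet (hγ t).1⟩, ?_⟩, ?_, ?_⟩, ?_⟩
  · exact Conf.continuous_toUPoly.comp (γ.continuous.subtype_mk _)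
  · exact congrArg Conf.toUPoly (Subtype.ext γ.source)
  · exact congrArg Conf.toUPoly (Subtype.ext γ.target)
  · intro t
    exact ⟨Conf.toUPoly_mem_chart _ 1 (hγ t).1, Conf.toUPoly_mem_chart _ w (hγ t).2⟩

variable (m) in
/-- The base point. -/
def diagConf : Conf m := ⟨diagPoint m, fun a b h => by
  simpa [diagPoint, Complex.ext_iff, Fin.val_inj] using h⟩

theorem joinedIn_chart_diagConf (c : Fin m →o ℝ) {x : UPoly m} (hx : x ∈ chart c) :
    JoinedIn (chart c) (diagConf m).toUPoly x :=
  (isPathConnected_chart c).joinedIn _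
    (Conf.toUPoly_mem_chart (diagConf m) 1 (diagPoint_mem_chartSet c)) _ hx

end Charts

section Sorting

variable {m : ℕ}

/-- The coordinates of a point, ordered lexicographically. -/
def lexCoord (z : Fin m → ℂ) (a : Fin m) : ℝ ×ₗ ℝ := toLex ((z a).re, (z a).im)

theorem lexCoord_lt_iff {z : Fin m → ℂ} {a b : Fin m} : lexCoord z a < lexCoord z b ↔
    (z a).re < (z b).re ∨ (z a).re = (z b).re ∧ (z a).im < (z b).im :=
  Prod.Lex.toLex_lt_toLex

theorem lexCoord_injective {z : Fin m → ℂ} (hz : Function.Injective z) :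
    Function.Injective (lexCoord z) := by
  intro a b h
  have := toLex_inj.1 h
  exact hz (Complex.ext (congrArg Prod.fst this) (congrArg Prod.snd this))

/-- The permutation that sorts a configuration lexicographically. -/
def sortPerm (z : Fin m → ℂ) : Equiv.Perm (Fin m) := Tuple.sort (lexCoord z)

theorem strictMono_lexCoord_sortPerm {z : Fin m → ℂ} (hz : Function.Injective z) :
    StrictMono (lexCoord z ∘ sortPerm z) :=
  (Tuple.monotone_sort _).strictMono_of_injective
    ((lexCoord_injective hz).comp (sortPerm z).injective)

theorem sortPerm_eq_of_strictMono {z : Fin m → ℂ} {w : Equiv.Perm (Fin m)}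
    (h : StrictMono (lexCoord z ∘ w)) : sortPerm z = w := by
  have hinj : Function.Injective (lexCoord z) := by
    have := h.injective.comp w.symm.injective
    rwa [Function.comp_assoc, Equiv.self_comp_symm, Function.comp_id] at this
  have hs : StrictMono (lexCoord z ∘ sortPerm z) :=
    (Tuple.monotone_sort _).strictMono_of_injective (hinj.comp (sortPerm z).injective)
  have e := (hs.range_inj h).1 (by simp [Set.range_comp])
  exact Equiv.ext fun a => hinj (congrFun e a)

theorem sortPerm_comp {z : Fin m → ℂ} (hz : Function.Injective z) (w : Equiv.Perm (Fin m)) :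
    sortPerm (z ∘ w) = w⁻¹ * sortPerm z := by
  refine sortPerm_eq_of_strictMono ?_
  convert strictMono_lexCoord_sortPerm hz using 1
  ext a
  simp [lexCoord]

variable (m) in
/-- The labels of the chart of configurations ordered by their real parts. -/
def reLabel : Fin m →o ℝ := ⟨fun a => (a : ℕ), fun _ _ h => Nat.cast_le.2 h⟩

variable (m) in
/-- The labels of the chart of configurations ordered by their imaginary parts. -/
def imLabel : Fin m →o ℝ := OrderHom.const _ 0

theorem mem_chartSet_reLabel {z : Fin m → ℂ} :
    z ∈ chartSet (reLabel m) ↔ StrictMono fun a => (z a).re := by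
  refine ⟨fun h a b hab => (h a b hab).1 (Nat.cast_lt.2 hab), fun h a b hab => ⟨fun _ => h hab,
    fun e => absurd (Nat.cast_injective e) (Fin.val_ne_of_ne hab.ne)⟩⟩

theorem mem_chartSet_imLabel {z : Fin m → ℂ} :
    z ∈ chartSet (imLabel m) ↔ StrictMono fun a => (z a).im :=
  ⟨fun h _ _ hab => (h _ _ hab).2 rfl, fun h _ _ hab => ⟨fun e => absurd e (lt_irrefl _),
    fun _ => h hab⟩⟩

theorem sortPerm_eq_of_mem_chartSet_reLabel {z : Fin m → ℂ} {w : Equiv.Perm (Fin m)}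
    (h : z ∘ w ∈ chartSet (reLabel m)) : sortPerm z = w :=
  sortPerm_eq_of_strictMono fun _ _ hab => lexCoord_lt_iff.2 (Or.inl (mem_chartSet_reLabel.1 h hab))

theorem exists_mem_chart (x : UPoly m) : ∃ c, x ∈ chart c := by
  obtain ⟨z, rfl⟩ := Conf.toUPoly_surjective x
  have h := strictMono_lexCoord_sortPerm z.2
  refine ⟨⟨fun a => (z.1 (sortPerm z.1 a)).re, fun a b hab => ?_⟩,
    z.toUPoly_mem_chart (sortPerm z.1) fun a b hab => ⟨fun h => h, fun e => ?_⟩⟩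
  · rcases hab.eq_or_lt with rfl | hab
    · exact le_rfl
    · rcases lexCoord_lt_iff.1 (h hab) with h | h
      exacts [h.le, h.1.le]
  · rcases lexCoord_lt_iff.1 (h hab) with h | h
    exacts [absurd e h.ne, h.2]

end Sorting

section Coord

open Topology

variable {n : ℕ} {c d : Fin (n + 1) →o ℝ}

open scoped Classical in
/-- The positive braid that sorts a configuration, starting from its labelling in a chart. -/
def chartCoord (c : Fin (n + 1) →o ℝ) (x : UPoly (n + 1)) : BraidGroup (n + 1) :=
  if h : x ∈ chart c then posLift (sortPerm h.choose.1) else 1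

theorem Conf.chartCoord_toUPoly (z : Conf (n + 1)) (w : Equiv.Perm (Fin (n + 1)))
    (h : z.1 ∘ w ∈ chartSet c) : chartCoord c z.toUPoly = posLift (w⁻¹ * sortPerm z.1) := by
  have hx := z.toUPoly_mem_chart w h
  rw [chartCoord, dif_pos hx, ← sortPerm_comp z.2]
  have : hx.choose = ⟨z.1 ∘ w, h⟩ := by
    refine (isOpenEmbedding_chartMap c).injective (hx.choose_spec.trans ?_)
    exact (z.toUPoly_relabel w).symm
  rw [this]

theorem posLift_sortPerm_of_re_lt {z z' : Fin (n + 1) → ℂ} (hz : z ∈ chartSet c)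
    (hz' : Function.Injective z')
    (h : ∀ a b, (z a).re < (z b).re → (z' a).re < (z' b).re) :
    posLift (sortPerm z') =
      posLift ((sortPerm z)⁻¹ * sortPerm z') * posLift (sortPerm z) := by
  rw [← posLift_mul, mul_inv_cancel_left]
  intro p q hpq hinv
  have h1 := strictMono_lexCoord_sortPerm (injective_of_mem_chartSet hz) hpq
  have h2 := strictMono_lexCoord_sortPerm hz' hinv
  have e : ∀ p, sortPerm z' (((sortPerm z)⁻¹ * sortPerm z')⁻¹ p) = sortPerm z p := fun p => by
    simp
  simp only [Function.comp_apply, e, lexCoord_lt_iff] at h1 h2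
  have hne := (sortPerm z).injective.ne hpq.ne
  generalize sortPerm z p = a at *
  generalize sortPerm z q = b at *
  have hle : (z' b).re ≤ (z' a).re := by
    rcases h2 with h2 | h2
    exacts [h2.le, h2.1.le]
  have h3 : (z a).re = (z b).re ∧ (z a).im < (z b).im :=
    h1.resolve_left fun h1 => (h _ _ h1).not_ge hle
  refine lt_of_le_of_ne (not_lt.1 fun hba => ?_) hne
  rcases (c.monotone hba.le).lt_or_eq with hc | hc
  · exact ((hz b a hba).1 hc).ne h3.1.symm
  · exact ((hz b a hba).2 hc).not_gt h3.2

theorem chartCoord_jump_eq {z z' : Conf (n + 1)} {w : Equiv.Perm (Fin (n + 1))}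
    (hz : z.1 ∈ chartSet c) (hzw : z.1 ∘ w ∈ chartSet d) (hz' : z'.1 ∈ chartSet c)
    (hzw' : z'.1 ∘ w ∈ chartSet d)
    (h : ∀ a b, (z.1 a).re < (z.1 b).re → (z'.1 a).re < (z'.1 b).re) :
    (chartCoord d z'.toUPoly)⁻¹ * chartCoord c z'.toUPoly =
      (chartCoord d z.toUPoly)⁻¹ * chartCoord c z.toUPoly := by
  rw [z.chartCoord_toUPoly 1 hz, z'.chartCoord_toUPoly 1 hz', z.chartCoord_toUPoly w hzw,
    z'.chartCoord_toUPoly w hzw', inv_one, one_mul, one_mul,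
    posLift_sortPerm_of_re_lt hz z'.2 h, ← sortPerm_comp z'.2,
    posLift_sortPerm_of_re_lt hzw (z'.2.comp w.injective) fun a b => h (w a) (w b),
    sortPerm_comp z.2, sortPerm_comp z'.2]
  have e : (w⁻¹ * sortPerm z.1)⁻¹ * (w⁻¹ * sortPerm z'.1) = (sortPerm z.1)⁻¹ * sortPerm z'.1 := by
    group
  rw [e]
  group

theorem eventually_re_lt (z : Fin (n + 1) → ℂ) :
    ∀ᶠ z' in 𝓝 z, ∀ a b, (z a).re < (z b).re → (z' a).re < (z' b).re := by
  simp only [Filter.eventually_all]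
  intro a b h
  exact ((Complex.continuous_re.comp (continuous_apply a)).tendsto z).eventually_lt
    ((Complex.continuous_re.comp (continuous_apply b)).tendsto z) h

theorem eventually_comp_mem_chartSet {z : Fin (n + 1) → ℂ} {w : Equiv.Perm (Fin (n + 1))}
    (h : z ∘ w ∈ chartSet d) : ∀ᶠ z' in 𝓝 z, z' ∘ w ∈ chartSet d :=
  ((isOpen_chartSet d).preimage (f := fun z : Fin (n + 1) → ℂ => z ∘ w) (by fun_prop)).mem_nhds h

theorem exists_conf_of_mem_chart {x : UPoly (n + 1)} (hc : x ∈ chart c) (hd : x ∈ chart d) :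
    ∃ (z : Conf (n + 1)) (w : Equiv.Perm (Fin (n + 1))), z.toUPoly = x ∧ z.1 ∈ chartSet c ∧
      z.1 ∘ w ∈ chartSet d := by
  obtain ⟨z, rfl⟩ := hc
  obtain ⟨z', hz'⟩ := hd
  obtain ⟨w, hw⟩ := Conf.exists_relabel_eq hz'.symm
  have hw' : z'.1 = z.1 ∘ w := congrArg Subtype.val hw
  exact ⟨⟨z.1, injective_of_mem_chartSet z.2⟩, w, rfl, z.2, by rw [← hw']; exact z'.2⟩

theorem eventually_chartCoord_jump_eq (c d : Fin (n + 1) →o ℝ) :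
    ∀ x ∈ chart c ∩ chart d, ∀ᶠ y in 𝓝 x,
      (chartCoord d y)⁻¹ * chartCoord c y = (chartCoord d x)⁻¹ * chartCoord c x := by
  rintro x ⟨hc, hd⟩
  obtain ⟨z, w, rfl, hz, hzw⟩ := exists_conf_of_mem_chart hc hd
  change ∀ᶠ y in 𝓝 (chartMap c ⟨z.1, hz⟩), _
  rw [← (isOpenEmbedding_chartMap c).map_nhds_eq, Filter.eventually_map]
  have := ((eventually_re_lt z.1).and (eventually_comp_mem_chartSet hzw))
  filter_upwards [(continuous_subtype_val.tendsto (⟨z.1, hz⟩ : chartSet c)).eventually this]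
    with z' hz'
  exact chartCoord_jump_eq (z' := ⟨z'.1, injective_of_mem_chartSet z'.2⟩) hz hzw z'.2 hz'.2 hz'.1

end Coord

section Loops

variable {m : ℕ} {c d e : Fin m →o ℝ} {x : UPoly m}

open scoped Classical in
/-- The loop that goes to a point in one chart and returns in another one. -/
def chartLoop (c d : Fin m →o ℝ) (x : UPoly m) : FundamentalGroup (UPoly m) (diagConf m).toUPoly :=
  if h : x ∈ chart c ∧ x ∈ chart d then
    bigonLoop (joinedIn_chart_diagConf c h.1) (joinedIn_chart_diagConf d h.2) else 1

theorem bigonLoop_eq_chartLoop (H : JoinedIn (chart c) (diagConf m).toUPoly x)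
    (H' : JoinedIn (chart d) (diagConf m).toUPoly x) : bigonLoop H H' = chartLoop c d x := by
  rw [chartLoop, dif_pos ⟨H.target_mem, H'.target_mem⟩]

theorem chartLoop_mul (hc : x ∈ chart c) (hd : x ∈ chart d) (he : x ∈ chart e) :
    chartLoop d e x * chartLoop c d x = chartLoop c e x := by
  rw [chartLoop, chartLoop, chartLoop, dif_pos ⟨hd, he⟩, dif_pos ⟨hc, hd⟩, dif_pos ⟨hc, he⟩,
    bigonLoop_mul]

theorem inv_chartLoop (hc : x ∈ chart c) (hd : x ∈ chart d) :
    (chartLoop c d x)⁻¹ = chartLoop d c x := by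
  rw [chartLoop, chartLoop, dif_pos ⟨hc, hd⟩, dif_pos ⟨hd, hc⟩, bigonLoop_inv]

theorem chartLoop_toUPoly_eq {z z' : Conf m} (w : Equiv.Perm (Fin m))
    (hz : z.1 ∈ chartSet c) (hz' : z'.1 ∈ chartSet c) (hzw : z.1 ∘ w ∈ chartSet d)
    (hzw' : z'.1 ∘ w ∈ chartSet d) : chartLoop c d z.toUPoly = chartLoop c d z'.toUPoly := by
  rw [chartLoop, chartLoop, dif_pos ⟨z.toUPoly_mem_chart 1 hz, z.toUPoly_mem_chart w hzw⟩,
    dif_pos ⟨z'.toUPoly_mem_chart 1 hz', z'.toUPoly_mem_chart w hzw'⟩]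
  exact bigonLoop_eq_of_joinedIn (relSimplyConnected_chart c) (relSimplyConnected_chart d)
    (Conf.joinedIn_chart_inter_chart w hz hz' hzw hzw') _ _ _ _

theorem chartLoop_toUPoly_eq_one {z : Conf m} (hc : z.1 ∈ chartSet c) (hd : z.1 ∈ chartSet d) :
    chartLoop c d z.toUPoly = 1 := by
  rw [chartLoop, dif_pos ⟨z.toUPoly_mem_chart 1 hc, z.toUPoly_mem_chart 1 hd⟩]
  exact bigonLoop_eq_one (relSimplyConnected_chart c) (relSimplyConnected_chart d)
    (Conf.joinedIn_chart_inter_chart (z := diagConf m) 1 (diagPoint_mem_chartSet c) hc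
      (diagPoint_mem_chartSet d) hd) _ _

/-- The configuration whose points are at height `a` and at abscissa `u⁻¹ a`. -/
def modelConf (u : Equiv.Perm (Fin m)) : Conf m :=
  ⟨fun a => ⟨(u⁻¹ a : ℕ), (a : ℕ)⟩, fun a b h => by simpa [Fin.val_inj] using congrArg Complex.im h⟩

theorem modelConf_mem_chartSet_imLabel (u : Equiv.Perm (Fin m)) :
    (modelConf u).1 ∈ chartSet (imLabel m) :=
  mem_chartSet_imLabel.2 fun _ _ h => Nat.cast_lt.2 h

theorem modelConf_comp_mem_chartSet_reLabel (u : Equiv.Perm (Fin m)) :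
    (modelConf u).1 ∘ u ∈ chartSet (reLabel m) :=
  mem_chartSet_reLabel.2 fun a b h => by simpa [modelConf] using h

/-- The loop attached to a permutation. -/
def permLoop (u : Equiv.Perm (Fin m)) : FundamentalGroup (UPoly m) (diagConf m).toUPoly :=
  chartLoop (imLabel m) (reLabel m) (modelConf u).toUPoly

theorem chartLoop_reLabel {z : Conf m} {u : Equiv.Perm (Fin m)} (hz : z.1 ∈ chartSet c)
    (hzu : z.1 ∘ u ∈ chartSet (reLabel m)) :
    chartLoop c (reLabel m) z.toUPoly = permLoop u := by
  let z' : Conf m := ⟨fun a => ⟨(z.1 a).re, (a : ℕ)⟩, fun a b h => by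
    simpa [Fin.val_inj] using congrArg Complex.im h⟩
  have hc : z'.1 ∈ chartSet c := fun a b hab =>
    ⟨(hz a b hab).1, fun _ => Nat.cast_lt.2 hab⟩
  have him : z'.1 ∈ chartSet (imLabel m) :=
    mem_chartSet_imLabel.2 fun _ _ h => Nat.cast_lt.2 h
  have hre : z'.1 ∘ u ∈ chartSet (reLabel m) :=
    mem_chartSet_reLabel.2 fun _ _ h => mem_chartSet_reLabel.1 hzu h
  rw [chartLoop_toUPoly_eq u hz hc hzu hre, ← chartLoop_mul (z'.toUPoly_mem_chart 1 hc)
    (z'.toUPoly_mem_chart 1 him) (z'.toUPoly_mem_chart u hre), chartLoop_toUPoly_eq_one hc him,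
    mul_one, permLoop, chartLoop_toUPoly_eq u him (modelConf_mem_chartSet_imLabel u) hre
    (modelConf_comp_mem_chartSet_reLabel u)]

theorem permLoop_one : permLoop (1 : Equiv.Perm (Fin m)) = 1 :=
  chartLoop_toUPoly_eq_one (modelConf_mem_chartSet_imLabel 1)
    (modelConf_comp_mem_chartSet_reLabel 1)

theorem chartLoop_eq_inv_permLoop_mul {z : Conf m} {u w : Equiv.Perm (Fin m)}
    (hz : z.1 ∈ chartSet c) (hzw : z.1 ∘ w ∈ chartSet d) (hzu : z.1 ∘ u ∈ chartSet (reLabel m)) :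
    chartLoop c d z.toUPoly = (permLoop (w⁻¹ * u))⁻¹ * permLoop u := by
  have hc := z.toUPoly_mem_chart 1 hz
  have hd := z.toUPoly_mem_chart w hzw
  have hr := z.toUPoly_mem_chart u hzu
  have h : chartLoop d (reLabel m) z.toUPoly = permLoop (w⁻¹ * u) := by
    rw [← z.toUPoly_relabel w]
    refine chartLoop_reLabel hzw ?_
    rw [Conf.relabel, Function.comp_assoc, ← Equiv.Perm.coe_mul, mul_inv_cancel_left]
    exact hzu
  rw [← h, ← chartLoop_reLabel hz hzu, inv_chartLoop hd hr, chartLoop_mul hc hr hd]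

end Loops

section Presentation

open Topology

variable {n : ℕ}

/-- The labels of the chart of configurations ordered by their real parts, except for two
consecutive points that are ordered by their imaginary parts. -/
def wallLabel (i : Fin n) : Fin (n + 1) →o ℝ :=
  ⟨fun a => ((if a = i.succ then i else a : ℕ) : ℝ), fun a b h => by
    have : (a : ℕ) ≤ b := h
    rw [Nat.cast_le]
    split_ifs <;> simp_all [Fin.ext_iff] <;> omega⟩

theorem permLoop_mul_adjSwap (u : Equiv.Perm (Fin (n + 1))) (i : Fin n)
    (h : u i.castSucc < u i.succ) :
    permLoop (u * adjSwap i) = permLoop (adjSwap i) * permLoop u := by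
  have key : ∀ a b : Fin (n + 1), a < b → wallLabel i a = wallLabel i b → u a < u b := by
    intro a b hab e
    have hab' : (a : ℕ) < b := hab
    simp only [wallLabel, OrderHom.coe_mk, Nat.cast_inj, Fin.ext_iff, Fin.val_succ] at e
    obtain rfl : a = i.castSucc :=
      Fin.ext (by simp only [Fin.val_castSucc]; split_ifs at e <;> omega)
    obtain rfl : b = i.succ := Fin.ext (by simp only [Fin.val_succ]; split_ifs at e <;> omega)
    exact h
  have h1 : (modelConf u).1 ∘ u ∈ chartSet (wallLabel i) := by
    refine fun a b hab => ⟨fun _ => ?_, fun e => ?_⟩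
    · simpa [modelConf] using hab
    · simpa [modelConf] using key a b hab e
  have h2 : (modelConf (u * adjSwap i)).1 ∘ u ∈ chartSet (wallLabel i) := by
    refine fun a b hab => ⟨fun e => ?_, fun e => ?_⟩
    · have hab' : (a : ℕ) < b := hab
      simp only [wallLabel, OrderHom.coe_mk, Nat.cast_lt, Fin.ext_iff, Fin.val_succ] at e
      suffices (adjSwap i a : ℕ) < adjSwap i b by simpa [modelConf] using this
      simp only [val_adjSwap]
      split_ifs at e ⊢ <;> omega
    · simpa [modelConf] using key a b hab e
  have im1 := modelConf_mem_chartSet_imLabel u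
  have im2 := modelConf_mem_chartSet_imLabel (u * adjSwap i)
  have re1 := modelConf_comp_mem_chartSet_reLabel u
  have re2 := modelConf_comp_mem_chartSet_reLabel (u * adjSwap i)
  have e1 := chartLoop_eq_inv_permLoop_mul im1 h1 re1
  have e2 := chartLoop_eq_inv_permLoop_mul im2 h2 re2
  rw [chartLoop_toUPoly_eq u im2 im1 h2 h1, e1] at e2
  rw [inv_mul_cancel, permLoop_one, inv_one, one_mul, inv_mul_cancel_left] at e2
  rw [e2, mul_inv_cancel_left]

theorem exists_conf_strictMono_re {c d : Fin (n + 1) →o ℝ} {z : Conf (n + 1)}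
    {w : Equiv.Perm (Fin (n + 1))} (hz : z.1 ∈ chartSet c) (hzw : z.1 ∘ w ∈ chartSet d) :
    ∃ z' : Conf (n + 1), z'.1 ∈ chartSet c ∧ z'.1 ∘ w ∈ chartSet d ∧
      (∀ a b, (z.1 a).re < (z.1 b).re → (z'.1 a).re < (z'.1 b).re) ∧
      z'.1 ∘ sortPerm z'.1 ∈ chartSet (reLabel (n + 1)) := by
  let f : ℝ → Fin (n + 1) → ℂ := fun t a => z.1 a + ((t * (a : ℕ) : ℝ) : ℂ)
  have hf : Filter.Tendsto f (𝓝[≠] 0) (𝓝 z.1) := by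
    have : Continuous f := by fun_prop
    convert (this.tendsto 0).mono_left nhdsWithin_le_nhds using 2
    simp [f]
  have h1 := eventually_comp_mem_chartSet (w := 1) (by exact hz)
  obtain ⟨t, ⟨⟨h1, h2⟩, h3⟩, ht⟩ := ((hf.eventually ((h1.and (eventually_comp_mem_chartSet
    hzw)).and (eventually_re_lt z.1))).and self_mem_nhdsWithin).exists
  have hinj := injective_of_mem_chartSet h1
  refine ⟨⟨f t, hinj⟩, h1, h2, h3, mem_chartSet_reLabel.2 fun a b hab => ?_⟩
  rcases lexCoord_lt_iff.1 (strictMono_lexCoord_sortPerm hinj hab) with h | ⟨h, -⟩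
  · exact h
  · have hne := (sortPerm (f t)).injective.ne hab.ne
    change (f t (sortPerm (f t) a)).re = (f t (sortPerm (f t) b)).re at h
    generalize sortPerm (f t) a = p at *
    generalize sortPerm (f t) b = q at *
    rcases lt_trichotomy (z.1 p).re (z.1 q).re with h' | h' | h'
    · exact absurd h (h3 _ _ h').ne
    · simp only [f, Complex.add_re, h', Complex.ofReal_re, add_right_inj] at h
      exact absurd (Fin.ext (Nat.cast_injective (mul_left_cancel₀ ht h))) hne
    · exact absurd h (h3 _ _ h').ne'

theorem chartLoop_eq_of_map_posLift
    {φ : BraidGroup (n + 1) →* FundamentalGroup (UPoly (n + 1)) (diagConf (n + 1)).toUPoly}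
    (hφ : ∀ u, φ (posLift u) = permLoop u) {c d : Fin (n + 1) →o ℝ} {x : UPoly (n + 1)}
    (hc : x ∈ chart c) (hd : x ∈ chart d) :
    chartLoop c d x = φ ((chartCoord d x)⁻¹ * chartCoord c x) := by
  obtain ⟨z, w, rfl, hz, hzw⟩ := exists_conf_of_mem_chart hc hd
  obtain ⟨z', hz', hzw', hlt, hre⟩ := exists_conf_strictMono_re hz hzw
  rw [← chartCoord_jump_eq hz hzw hz' hzw' hlt, chartLoop_toUPoly_eq w hz hz' hzw hzw',
    chartLoop_eq_inv_permLoop_mul hz' hzw' hre, z'.chartCoord_toUPoly 1 hz',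
    z'.chartCoord_toUPoly w hzw', map_mul, map_inv, hφ, hφ, inv_one, one_mul]

theorem exists_bijective_monoidHom_fundamentalGroup :
    ∃ φ : BraidGroup (n + 1) →* FundamentalGroup (UPoly (n + 1)) (diagConf (n + 1)).toUPoly,
      Function.Bijective φ := by
  obtain ⟨φ, hφ⟩ := exists_monoidHom_posLift permLoop permLoop_one permLoop_mul_adjSwap
  have hloop : ∀ (c d : Fin (n + 1) →o ℝ) (x : UPoly (n + 1))
      (H : JoinedIn (chart c) (diagConf (n + 1)).toUPoly x)
      (H' : JoinedIn (chart d) (diagConf (n + 1)).toUPoly x),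
      bigonLoop H H' = φ ((chartCoord d x)⁻¹ * chartCoord c x) := fun c d x H H' => by
    rw [bigonLoop_eq_chartLoop, chartLoop_eq_of_map_posLift hφ H.target_mem H'.target_mem]
  have hbase : ∀ c, chartCoord c (diagConf (n + 1)).toUPoly = 1 := fun c => by
    rw [(diagConf (n + 1)).chartCoord_toUPoly 1 (diagPoint_mem_chartSet c),
      sortPerm_eq_of_mem_chartSet_reLabel (w := 1) (diagPoint_mem_chartSet _), inv_one, one_mul,
      posLift_one]
  refine ⟨φ, ?_, ?_⟩
  · refine injective_of_bigonLoop_eq isOpen_chart exists_mem_chart eventually_chartCoord_jump_eq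
      hbase _ closure_range_braidGen ?_
    rintro _ ⟨i, rfl⟩
    have him := modelConf_mem_chartSet_imLabel (adjSwap i)
    have hre := modelConf_comp_mem_chartSet_reLabel (adjSwap i)
    have e : braidGen i =
        (chartCoord (reLabel (n + 1)) (modelConf (adjSwap i)).toUPoly)⁻¹ *
          chartCoord (imLabel (n + 1)) (modelConf (adjSwap i)).toUPoly := by
      rw [Conf.chartCoord_toUPoly _ 1 him, Conf.chartCoord_toUPoly _ _ hre,
        sortPerm_eq_of_mem_chartSet_reLabel hre, inv_mul_cancel, posLift_one, inv_one, one_mul,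
        inv_one, one_mul, posLift_adjSwap]
    refine ⟨imLabel _, reLabel _, (modelConf (adjSwap i)).toUPoly,
      joinedIn_chart_diagConf _ (Conf.toUPoly_mem_chart _ 1 him),
      joinedIn_chart_diagConf _ (Conf.toUPoly_mem_chart _ _ hre), ?_, e⟩
    rw [hloop, ← e]
  · exact surjective_of_bigonLoop_eq isOpen_chart exists_mem_chart
      (fun c x hx => joinedIn_chart_diagConf c hx) relSimplyConnected_chart hloop

instance pathConnectedSpace_UPoly {m : ℕ} : PathConnectedSpace (UPoly m) := by
  have h : ∀ x : UPoly m, Joined (diagConf m).toUPoly x := fun x => by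
    obtain ⟨c, hc⟩ := exists_mem_chart x
    exact (joinedIn_chart_diagConf c hc).joined
  exact ⟨⟨(diagConf m).toUPoly⟩, fun x y => (h x).symm.trans (h y)⟩

end Presentation

/-- For every `m ≥ 1` and every basepoint `p₀ ∈ U_m`, the fundamental group
`π₁(U_m, p₀)` is isomorphic to the braid group `Br_m`. -/
theorem fundamentalGroup_UPoly_iso_braidGroup (m : ℕ) (hm : 1 ≤ m) (p₀ : UPoly m) :
    Nonempty (FundamentalGroup (UPoly m) p₀ ≃* BraidGroup m) := by
  obtain ⟨n, rfl⟩ : ∃ n, m = n + 1 := ⟨m - 1, by omega⟩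
  obtain ⟨φ, hφ⟩ := exists_bijective_monoidHom_fundamentalGroup (n := n)
  exact ⟨(FundamentalGroup.fundamentalGroupMulEquivOfPathConnected p₀ _).trans
    (MulEquiv.ofBijective φ hφ).symm⟩

end
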